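/- Let φ be holomorphic on the open unit disk D and let Δ be a domain (open connected set) in ℂ. If Δ₀ is a connected component of φ^{-1}(Δ) whose closure is contained in D, then the restriction φ|_{Δ₀} : Δ₀ → Δ is a proper map onto Δ. -/

import Mathlib

open Metric Set

theorem component_with_compact_closure_proper_onto
    (φ : ℂ → ℂ) (hφ : DifferentiableOn ℂ φ (ball (0:ℂ) 1))
    (Δ : Set ℂ) (hΔo : IsOpen Δ) (hΔc : IsConnected Δ)
    (x : ℂ) (hx : x ∈ ball (0:ℂ) 1 ∩ φ ⁻¹' Δ)
    (Δ₀ : Set ℂ) (hΔ₀ : Δ₀ = connectedComponentIn (ball (0:ℂ) 1 ∩ φ ⁻¹' Δ) x)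
    (hcl : closure Δ₀ ⊆ ball (0:ℂ) 1) :
    φ '' Δ₀ = Δ ∧ ∀ K ⊆ Δ, IsCompact K → IsCompact (Δ₀ ∩ φ ⁻¹' K) := by
  have hUo : IsOpen (ball (0:ℂ) 1 ∩ φ ⁻¹' Δ) :=
    hφ.continuousOn.isOpen_inter_preimage isOpen_ball hΔo
  have hsub : Δ₀ ⊆ ball (0:ℂ) 1 ∩ φ ⁻¹' Δ := hΔ₀ ▸ connectedComponentIn_subset _ _
  have hopen : IsOpen Δ₀ := hΔ₀ ▸ hUo.connectedComponentIn
  have hpre : IsPreconnected Δ₀ := hΔ₀ ▸ isPreconnected_connectedComponentIn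
  have hxm : x ∈ Δ₀ := hΔ₀ ▸ mem_connectedComponentIn hx
  have key : ∀ y ∈ closure Δ₀, φ y ∈ Δ → y ∈ Δ₀ := by
    intro y hy hyΔ
    have h1 : IsPreconnected (insert y Δ₀) :=
      hpre.subset_closure (subset_insert _ _) (insert_subset hy subset_closure)
    have h2 : insert y Δ₀ ⊆ connectedComponentIn (ball (0:ℂ) 1 ∩ φ ⁻¹' Δ) x :=
      h1.subset_connectedComponentIn (mem_insert_of_mem _ hxm)
        (insert_subset ⟨hcl hy, hyΔ⟩ hsub)
    rw [hΔ₀]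
    exact h2 (mem_insert _ _)
  have hcomp : IsCompact (closure Δ₀) :=
    (isBounded_ball.subset (fun z hz => (hsub hz).1)).isCompact_closure
  have hcont : ContinuousOn φ (closure Δ₀) := hφ.continuousOn.mono hcl
  refine ⟨?_, ?_⟩
  · have himg : IsOpen (φ '' Δ₀) := by
      rcases (hφ.analyticOnNhd isOpen_ball).is_constant_or_isOpen
        (convex_ball (0:ℂ) 1).isPreconnected with ⟨w, hw⟩ | h
      · exfalso
        have hb : ball (0:ℂ) 1 ⊆ Δ₀ := by
          rw [hΔ₀]
          refine (convex_ball (0:ℂ) 1).isPreconnected.subset_connectedComponentIn hx.1 ?_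
          intro z hz
          refine ⟨hz, ?_⟩
          have : φ x ∈ Δ := hx.2
          rw [mem_preimage, hw z hz, ← hw x hx.1]
          exact this
        have h1 : (1:ℂ) ∈ closure (ball (0:ℂ) 1) := by
          rw [closure_ball _ one_ne_zero]; simp
        have := hcl (closure_mono hb h1)
        simp at this
      · exact h Δ₀ (fun z hz => (hsub hz).1) hopen
    refine Subset.antisymm (image_subset_iff.2 fun z hz => (hsub hz).2) ?_
    refine hΔc.isPreconnected.subset_of_closure_inter_subset himg
      ⟨φ x, hx.2, mem_image_of_mem _ hxm⟩ ?_
    rintro w ⟨hw, hwΔ⟩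
    have h3 : closure (φ '' Δ₀) ⊆ φ '' closure Δ₀ :=
      closure_minimal (image_mono subset_closure) (hcomp.image_of_continuousOn hcont).isClosed
    obtain ⟨y, hy, rfl⟩ := h3 hw
    exact mem_image_of_mem _ (key y hy hwΔ)
  · intro K hK hKc
    have heq : Δ₀ ∩ φ ⁻¹' K = closure Δ₀ ∩ φ ⁻¹' K :=
      Subset.antisymm (inter_subset_inter_left _ subset_closure)
        (fun y hy => ⟨key y hy.1 (hK hy.2), hy.2⟩)
    rw [heq]
    exact hcomp.of_isClosed_subset
      (hcont.preimage_isClosed_of_isClosed isClosed_closure hKc.isClosed) inter_subset_left
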